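/- arXiv:1306.1189 — 2 statements merged into one kernel-verified Lean document; each statement's English description precedes it below -/
import Mathlib

section
/- For elementary cellular automaton rule 160 and every n ≥ 0, the density polynomial of the set of n-step preimages of 1 satisfies Σ_{b ∈ 𝐟₁₆₀⁻ⁿ(1)} p^{#₁(b)} q^{#₀(b)} = p^{n+1}(p+q)^{n} (an identity of polynomials in p and q); in particular, substituting q = 1−p, the density of ones after n iterations of rule 160 starting from a Bernoulli distribution with density c₀ is c_n = c₀^{n+1}. -/
/-- Block evolution operator of a radius-1 elementary CA local rule:
it maps a block `b₁…b_m` (`m ≥ 3`) to the block of length `m-2` whose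
`i`-th symbol is `f b_i b_{i+1} b_{i+2}`. -/
def blockMap (f : Bool → Bool → Bool → Bool) : List Bool → List Bool
  | a :: b :: c :: rest => f a b c :: blockMap f (b :: c :: rest)
  | _ => []

/-- Local rule 160: `f₁₆₀(x₁,x₂,x₃) = x₁·x₃`. -/
def f160 (x₁ _x₂ x₃ : Bool) : Bool := x₁ && x₃

/-- All symbols of the block at even (zero-based) positions are ones. -/
def evensTrue : List Bool → Bool
  | a :: _ :: rest => a && evensTrue rest
  | [a] => a
  | [] => true

theorem length_blockMap (f : Bool → Bool → Bool → Bool) :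
    ∀ l : List Bool, (blockMap f l).length = l.length - 2
  | a :: b :: c :: rest => by
    simp [blockMap, length_blockMap f (b :: c :: rest)]
  | [] => rfl
  | [_] => rfl
  | [_, _] => rfl

theorem evensTrue_blockMap_f160 :
    ∀ (n : ℕ) (l : List Bool), l.length = 2 * n + 3 →
      evensTrue (blockMap f160 l) = evensTrue l
  | 0, [a, b, c], _ => by simp [blockMap, evensTrue, f160]
  | n + 1, a :: b :: c :: d :: e :: rest, h => by
    have ih := evensTrue_blockMap_f160 n (c :: d :: e :: rest)
      (by simp only [List.length_cons] at h ⊢; omega)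
    have step : evensTrue (blockMap f160 (a :: b :: c :: d :: e :: rest)) =
        (f160 a b c && evensTrue (blockMap f160 (c :: d :: e :: rest))) := rfl
    rw [step, ih]
    cases a <;> cases c <;> simp [evensTrue, f160]

theorem iterate_blockMap_f160_eq_true_iff (n : ℕ) :
    ∀ l : List Bool, l.length = 2 * n + 1 →
      ((blockMap f160)^[n] l = [true] ↔ evensTrue l = true) := by
  induction n with
  | zero =>
    intro l h
    obtain ⟨a, rfl⟩ := List.length_eq_one_iff.mp h
    simp [evensTrue]
  | succ n ih =>
    intro l h
    rw [Function.iterate_succ_apply, ih _ (by rw [length_blockMap]; omega),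
      evensTrue_blockMap_f160 n l (by omega)]

theorem sum_ofFn_bool_succ {M : Type*} [AddCommMonoid M] (m : ℕ) (F : List Bool → M) :
    ∑ b : Fin (m + 1) → Bool, F (List.ofFn b) =
      ∑ b : Fin m → Bool, (F (true :: List.ofFn b) + F (false :: List.ofFn b)) := by
  rw [← (Fin.consEquiv fun _ : Fin (m + 1) => Bool).sum_comp, Fintype.sum_prod_type,
    Fintype.sum_bool, ← Finset.sum_add_distrib]
  simp [Fin.consEquiv, List.ofFn_succ]

theorem sum_evensTrue {R : Type*} [CommSemiring R] (p q : R) (n : ℕ) :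
    ∑ b : Fin (2 * n + 1) → Bool,
      (if evensTrue (List.ofFn b) = true then
        p ^ (List.ofFn b).count true * q ^ (List.ofFn b).count false else 0) =
      p ^ (n + 1) * (p + q) ^ n := by
  let F : List Bool → R := fun l =>
    if evensTrue l = true then p ^ l.count true * q ^ l.count false else 0
  change ∑ b : Fin (2 * n + 1) → Bool, F (List.ofFn b) = _
  induction n with
  | zero =>
    rw [sum_ofFn_bool_succ]
    simp [F, evensTrue]
  | succ n ih =>
    have key (l : List Bool) : F (true :: true :: l) + F (false :: true :: l) +
        (F (true :: false :: l) + F (false :: false :: l)) = p * (p + q) * F l := by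
      by_cases h : evensTrue l = true
      · simp [F, evensTrue, h]
        ring
      · simp [F, evensTrue, h]
    calc ∑ b : Fin (2 * n + 1 + 1 + 1) → Bool, F (List.ofFn b)
        = ∑ b : Fin (2 * n + 1) → Bool, p * (p + q) * F (List.ofFn b) := by
          rw [sum_ofFn_bool_succ,
            sum_ofFn_bool_succ (F := fun l => F (true :: l) + F (false :: l))]
          exact Finset.sum_congr rfl fun b _ => key _
      _ = p ^ (n + 1 + 1) * (p + q) ^ (n + 1) := by
          rw [← Finset.mul_sum, ih]
          ring

/-- For rule 160 and every `n ≥ 0`, the density polynomial of the set of `n`-step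
preimages of `1` is `Σ_{b ∈ 𝐟₁₆₀⁻ⁿ(1)} p^{#₁(b)} q^{#₀(b)} = p^{n+1}(p+q)^n`;
in particular, substituting `q = 1 - p` with `p = c₀`, the density of ones after
`n` iterations of rule 160 starting from a Bernoulli distribution with density
`c₀` is `c_n = c₀^{n+1}`. -/
theorem rule160_density (n : ℕ) :
    (∀ p q : ℝ,
      ∑ b ∈ Finset.univ.filter
          (fun b : Fin (2*n+1) → Bool => (blockMap f160)^[n] (List.ofFn b) = [true]),
        p ^ (List.ofFn b).count true * q ^ (List.ofFn b).count false
      = p ^ (n+1) * (p + q) ^ n) ∧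
    (∀ c₀ : ℝ,
      ∑ b ∈ Finset.univ.filter
          (fun b : Fin (2*n+1) → Bool => (blockMap f160)^[n] (List.ofFn b) = [true]),
        c₀ ^ (List.ofFn b).count true * (1 - c₀) ^ (List.ofFn b).count false
      = c₀ ^ (n+1)) := by
  have main (p q : ℝ) :
      ∑ b ∈ Finset.univ.filter
          (fun b : Fin (2*n+1) → Bool => (blockMap f160)^[n] (List.ofFn b) = [true]),
        p ^ (List.ofFn b).count true * q ^ (List.ofFn b).count false
      = p ^ (n+1) * (p + q) ^ n := by
    rw [← sum_evensTrue, Finset.sum_filter]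
    refine Finset.sum_congr rfl fun b _ => ?_
    simp only [iterate_blockMap_f160_eq_true_iff n _ (List.length_ofFn (f := b))]
  refine ⟨main, fun c₀ => ?_⟩
  rw [main, add_sub_cancel, one_pow, mul_one]
end

section
/- For elementary cellular automaton rule 140 and every n ≥ 0 and every c₀ ∈ [0,1], the density of ones after n iterations starting from a Bernoulli distribution with density c₀ satisfies Σ_{b ∈ 𝐟₁₄₀⁻ⁿ(1)} c₀^{#₁(b)} (1−c₀)^{#₀(b)} = c₀(1−c₀) + c₀^{n+2}. -/
/-- Local rule 140: `f₁₄₀(1,1,1) = f₁₄₀(0,1,1) = f₁₄₀(0,1,0) = 1`, and `0` otherwise. -/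
def f140 (x₁ x₂ x₃ : Bool) : Bool := (x₁ && x₂ && x₃) || (!x₁ && x₂)

/-- The evolution operator of a local rule on one-sided infinite configurations. -/
def seqMap (f : Bool → Bool → Bool → Bool) (x : ℕ → Bool) (i : ℕ) : Bool :=
  f (x i) (x (i + 1)) (x (i + 2))

theorem blockMap_ofFn (f : Bool → Bool → Bool → Bool) (m : ℕ) (x : ℕ → Bool) :
    blockMap f (List.ofFn fun i : Fin (m + 2) => x i) =
      List.ofFn fun i : Fin m => seqMap f x i := by
  induction m generalizing x with
  | zero => simp [List.ofFn_succ, blockMap]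
  | succ m ih =>
    have h := ih fun i => x (i + 1)
    simp only [List.ofFn_succ, Fin.val_succ, Fin.val_zero] at h ⊢
    rw [blockMap, h]
    rfl

theorem iterate_blockMap_ofFn (f : Bool → Bool → Bool → Bool) (n : ℕ) (x : ℕ → Bool) :
    (blockMap f)^[n] (List.ofFn fun i : Fin (2 * n + 1) => x i) = [(seqMap f)^[n] x 0] := by
  induction n generalizing x with
  | zero => simp
  | succ n ih =>
    rw [Function.iterate_succ_apply, Function.iterate_succ_apply, ← ih]
    exact congrArg _ (blockMap_ofFn f (2 * n + 1) x)

/-- Under rule 140, a cell is alive after `n + 1` steps iff it starts alive and either its left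
neighbour is dead or the `n + 1` cells to its right are all alive. -/
theorem iterate_seqMap_f140 (n : ℕ) (x : ℕ → Bool) :
    (seqMap f140)^[n + 1] x 0 = true ↔
      x (n + 1) = true ∧ (x n = false ∨ ∀ i ≤ n, x (n + 2 + i) = true) := by
  induction n generalizing x with
  | zero =>
    simp only [seqMap, f140, Function.iterate_one, zero_add]
    cases x 0 <;> cases x 1 <;> simp
  | succ n ih =>
    rw [Function.iterate_succ_apply, ih]
    have step (j : ℕ) : seqMap f140 x j = true ↔
        x (j + 1) = true ∧ (x j = false ∨ x (j + 2) = true) := by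
      simp only [seqMap, f140]
      cases x j <;> cases x (j + 1) <;> simp
    rw [← Bool.not_eq_true (seqMap f140 x n)]
    simp only [step]
    constructor
    · rintro ⟨⟨hc, hr⟩, h⟩
      refine ⟨hc, ?_⟩
      by_cases ha : x (n + 1) = true
      · right
        have hr : x (n + 3) = true := by simpa [ha] using hr
        have h : ∀ i ≤ n, _ := h.resolve_left fun h => h ⟨ha, Or.inr hc⟩
        intro i hi
        rcases Nat.lt_or_ge i (n + 1) with hin | hin
        · have := (h i (by omega)).1
          rwa [show n + 1 + 2 + i = n + 2 + i + 1 by omega]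
        · obtain rfl : i = n + 1 := by omega
          obtain ⟨hl, hn⟩ := h n le_rfl
          have hp : x (n + 2 + n) = true := by
            rcases n with _ | k
            · exact hc
            · have := (h k (by omega)).1
              rwa [show k + 1 + 2 + (k + 1) = k + 1 + 2 + k + 1 by omega]
          rw [show n + 1 + 2 + (n + 1) = n + 2 + n + 2 by omega]
          simpa [hp] using hn
      · exact Or.inl (by simpa using ha)
    · rintro ⟨hc, ha | h⟩
      · exact ⟨⟨hc, Or.inl ha⟩, Or.inl (by simp [ha])⟩
      · refine ⟨⟨hc, Or.inr (h 0 (by omega))⟩, Or.inr fun i hi => ⟨?_, Or.inr ?_⟩⟩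
        · have := h i (by omega)
          rwa [show n + 2 + i + 1 = n + 1 + 2 + i by omega]
        · have := h (i + 1) (by omega)
          rwa [show n + 2 + i + 2 = n + 1 + 2 + (i + 1) by omega]

theorem pow_count_ofFn (m : ℕ) (b : Fin m → Bool) (p q : ℝ) :
    p ^ (List.ofFn b).count true * q ^ (List.ofFn b).count false =
      ∏ i, if b i then p else q := by
  induction m with
  | zero => simp
  | succ m ih =>
    rw [Fin.prod_univ_succ, ← ih, List.ofFn_succ]
    cases b 0 <;> simp [pow_succ] <;> ring

theorem iterate_blockMap_f140_eq_true_iff (n : ℕ) (b : Fin (2 * (n + 1) + 1) → Bool) :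
    (blockMap f140)^[n + 1] (List.ofFn b) = [true] ↔
      (b ⟨n, by omega⟩ = false ∧ b ⟨n + 1, by omega⟩ = true) ∨ ∀ i, n ≤ i.val → b i = true := by
  let x : ℕ → Bool := fun i => if h : i < 2 * (n + 1) + 1 then b ⟨i, h⟩ else false
  have hx (i : ℕ) (h : i < 2 * (n + 1) + 1) : x i = b ⟨i, h⟩ := dif_pos h
  have hb : b = fun i : Fin (2 * (n + 1) + 1) => x i := funext fun i => (hx i i.2).symm
  rw [show List.ofFn b = List.ofFn fun i : Fin (2 * (n + 1) + 1) => x i from congrArg _ hb,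
    iterate_blockMap_ofFn, List.singleton_inj, iterate_seqMap_f140, ← hx, ← hx]
  have hall : (∀ i : Fin (2 * (n + 1) + 1), n ≤ i.val → b i = true) ↔
      x n = true ∧ x (n + 1) = true ∧ ∀ i ≤ n, x (n + 2 + i) = true := by
    constructor
    · intro h
      have h' (i : ℕ) (hi : i < 2 * (n + 1) + 1) (hn : n ≤ i) : x i = true :=
        (hx i hi).trans (h ⟨i, hi⟩ hn)
      exact ⟨h' _ (by omega) (by omega), h' _ (by omega) (by omega),
        fun i hi => h' _ (by omega) (by omega)⟩
    · rintro ⟨h0, h1, h2⟩ i hi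
      rw [← hx i i.2]
      obtain ⟨k, hk⟩ := Nat.exists_eq_add_of_le hi
      rw [hk]
      rcases k with _ | _ | k
      · exact h0
      · exact h1
      · rw [show n + (k + 1 + 1) = n + 2 + k by omega]
        exact h2 k (by omega)
  rw [hall]
  cases x n <;> simp

/-- For rule 140, every `n ≥ 0` and every `c₀ ∈ [0,1]`, the density of ones after
`n` iterations starting from a Bernoulli distribution with density `c₀` is
`c_n = c₀(1-c₀) + c₀^{n+2}`. -/
theorem rule140_density (n : ℕ) (c₀ : ℝ) (h0 : 0 ≤ c₀) (h1 : c₀ ≤ 1) :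
    ∑ b ∈ Finset.univ.filter
        (fun b : Fin (2*n+1) → Bool => (blockMap f140)^[n] (List.ofFn b) = [true]),
      c₀ ^ (List.ofFn b).count true * (1 - c₀) ^ (List.ofFn b).count false
    = c₀ * (1 - c₀) + c₀ ^ (n+2) := by
  simp only [pow_count_ofFn]
  rcases n with _ | n
  · have : Finset.univ.filter
        (fun b : Fin (2 * 0 + 1) → Bool => (blockMap f140)^[0] (List.ofFn b) = [true]) =
        {fun _ => true} := by decide
    rw [this]
    simp
    ring
  let S : Fin (2 * (n + 1) + 1) → Finset Bool := fun i =>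
    if i.val = n then {false} else if i.val = n + 1 then {true} else Finset.univ
  let T : Fin (2 * (n + 1) + 1) → Finset Bool := fun i =>
    if n ≤ i.val then {true} else Finset.univ
  have hS (b) : b ∈ Fintype.piFinset S ↔
      b ⟨n, by omega⟩ = false ∧ b ⟨n + 1, by omega⟩ = true := by
    rw [Fintype.mem_piFinset]
    constructor
    · intro h
      exact ⟨by simpa [S] using h ⟨n, by omega⟩, by simpa [S] using h ⟨n + 1, by omega⟩⟩
    · rintro ⟨h, h'⟩ ⟨i, hi⟩
      by_cases hn : i = n
      · subst hn; simpa [S] using h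
      · by_cases hn' : i = n + 1
        · subst hn'; simpa [S] using h'
        · simp [S, hn, hn']
  have hT (b) : b ∈ Fintype.piFinset T ↔ ∀ i, n ≤ i.val → b i = true := by
    rw [Fintype.mem_piFinset]
    refine forall_congr' fun i => ?_
    by_cases hn : n ≤ i.val <;> simp [T, hn]
  have hfilter : Finset.univ.filter (fun b : Fin (2 * (n + 1) + 1) → Bool =>
      (blockMap f140)^[n + 1] (List.ofFn b) = [true]) =
      Fintype.piFinset S ∪ Fintype.piFinset T := by
    ext b
    rw [Finset.mem_union, hS, hT, Finset.mem_filter_univ, iterate_blockMap_f140_eq_true_iff]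
  have hdisj : Disjoint (Fintype.piFinset S) (Fintype.piFinset T) := by
    refine Finset.disjoint_left.2 fun b hb hb' => ?_
    have := (hT b).1 hb' ⟨n, by omega⟩ le_rfl
    simp [((hS b).1 hb).1] at this
  rw [hfilter, Finset.sum_union hdisj,
    ← Finset.prod_univ_sum S fun _ j => if j then c₀ else 1 - c₀,
    ← Finset.prod_univ_sum T fun _ j => if j then c₀ else 1 - c₀]
  have hSw (i) : (∑ j ∈ S i, if j then c₀ else 1 - c₀) =
      (if i.val = n then 1 - c₀ else 1) * if i.val = n + 1 then c₀ else 1 := by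
    by_cases hn : i.val = n
    · simp [S, hn]
    · by_cases hn' : i.val = n + 1 <;> simp [S, hn, hn']
  have hTw (i) : (∑ j ∈ T i, if j then c₀ else 1 - c₀) = if n ≤ i.val then c₀ else 1 := by
    by_cases hn : n ≤ i.val <;> simp [T, hn]
  simp only [hSw, hTw]
  rw [Fin.prod_univ_eq_prod_range (fun i => (if i = n then 1 - c₀ else 1) *
      if i = n + 1 then c₀ else 1),
    Fin.prod_univ_eq_prod_range (fun i => if n ≤ i then c₀ else 1), Finset.prod_mul_distrib,
    Finset.prod_ite_eq', Finset.prod_ite_eq', if_pos (Finset.mem_range.2 (by omega)),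
    if_pos (Finset.mem_range.2 (by omega)), show 2 * (n + 1) + 1 = n + (n + 3) by omega,
    Finset.prod_range_add, Finset.prod_eq_one fun i hi =>
      if_neg (not_le.2 (Finset.mem_range.1 hi))]
  simp
  ring
end
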